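/- Let Δ : ℝ × ℝ^r → ℝ be twice continuously differentiable, nonnegative, with Δ(0, p) = 0 for all p, let Δ* > 0, and suppose for every p the set {t ≥ 0 : Δ(t, p) ≥ ε·Δ*} is nonempty for every ε > 0; define τ(ε, p) := sInf {t ≥ 0 : Δ(t, p) ≥ ε·Δ*}. Fix p₀ ∈ ℝ^r and ε > 0 with ∂ₜΔ(τ(ε, p₀), p₀) > 0. Then p ↦ τ(ε, p) is twice differentiable at p₀ and its Hessian is ∂ₚ²τ = − (1/∂ₜΔ)·( ∂ₜ²Δ · (∂ₚτ)(∂ₚτ)ᵀ + 2·S( (∂ₚτ)(∂ₚ∂ₜΔ)ᵀ ) + ∂ₚ²Δ ), where S(M) := (M + Mᵀ)/2 and all partial derivatives of Δ are evaluated at (τ(ε, p₀), p₀) while ∂ₚτ is evaluated at (ε, p₀). -/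

import Mathlib

open Matrix

open Filter Topology Set

section FirstHittingTime

variable {f : ℝ → ℝ} {c : ℝ}

theorem sInf_superlevel_mem (hf : Continuous f) (hne : {t : ℝ | 0 ≤ t ∧ c ≤ f t}.Nonempty) :
    sInf {t : ℝ | 0 ≤ t ∧ c ≤ f t} ∈ {t : ℝ | 0 ≤ t ∧ c ≤ f t} :=
  IsClosed.csInf_mem
    ((isClosed_le continuous_const continuous_id).inter (isClosed_le continuous_const hf))
    hne ⟨0, fun _ ht => ht.1⟩

theorem sInf_superlevel_le {t : ℝ} (ht : 0 ≤ t) (hc : c ≤ f t) :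
    sInf {t : ℝ | 0 ≤ t ∧ c ≤ f t} ≤ t :=
  csInf_le ⟨0, fun _ hs => hs.1⟩ ⟨ht, hc⟩

theorem apply_sInf_superlevel (hf : Continuous f) (h0 : f 0 < c)
    (hne : {t : ℝ | 0 ≤ t ∧ c ≤ f t}.Nonempty) :
    f (sInf {t : ℝ | 0 ≤ t ∧ c ≤ f t}) = c := by
  obtain ⟨hT, hc⟩ := sInf_superlevel_mem hf hne
  obtain ⟨s, hs, hsc⟩ := intermediate_value_Icc hT hf.continuousOn ⟨h0.le, hc⟩
  rwa [← le_antisymm hs.2 (sInf_superlevel_le hs.1 hsc.ge)]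

/-- The first hitting time of a level is continuous in the parameter where the level is crossed
transversally. -/
theorem tendsto_sInf_superlevel {X : Type*} [TopologicalSpace X] {F : X × ℝ → ℝ} {p₀ : X}
    (hF : Continuous F) (h0 : ∀ p, F (p, 0) < c)
    (hne : ∀ p, {t : ℝ | 0 ≤ t ∧ c ≤ F (p, t)}.Nonempty) {T : ℝ}
    (hT : T = sInf {t : ℝ | 0 ≤ t ∧ c ≤ F (p₀, t)})
    (hreg : 0 < deriv (fun t => F (p₀, t)) T) :
    Tendsto (fun p => sInf {t : ℝ | 0 ≤ t ∧ c ≤ F (p, t)}) (𝓝 p₀) (𝓝 T) := by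
  have hcont (p : X) : Continuous fun t => F (p, t) := by fun_prop
  have hT0 : 0 ≤ T := hT ▸ (sInf_superlevel_mem (hcont p₀) (hne p₀)).1
  have hTc : F (p₀, T) = c := hT ▸ apply_sInf_superlevel (hcont p₀) (h0 p₀) (hne p₀)
  refine tendsto_order.2 ⟨fun a ha => ?_, fun b hb => ?_⟩
  · have hlt : ∀ᶠ p in 𝓝 p₀, ∀ t ∈ Icc 0 a, F (p, t) < c := by
      refine isCompact_Icc.eventually_forall_of_forall_eventually fun t ht => ?_
      refine hF.continuousAt.eventually_lt continuousAt_const ?_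
      by_contra! hge
      exact (ht.2.trans_lt ha).not_ge (hT ▸ sInf_superlevel_le ht.1 hge)
    filter_upwards [hlt] with p hp
    by_contra! hle
    obtain ⟨h1, h2⟩ := sInf_superlevel_mem (hcont p) (hne p)
    exact (hp _ ⟨h1, hle⟩).not_ge h2
  · have hder : HasDerivAt (fun t => F (p₀, t)) (deriv (fun t => F (p₀, t)) T) T :=
      (differentiableAt_of_deriv_ne_zero hreg.ne').hasDerivAt
    have hslope : ∀ᶠ t in 𝓝[>] T, 0 < slope (fun t => F (p₀, t)) T t :=
      ((hasDerivAt_iff_tendsto_slope.1 hder).mono_left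
        (nhdsWithin_mono _ fun _ ht => ne_of_gt ht)).eventually_const_lt hreg
    obtain ⟨s, hs, hTs, hsb⟩ := (hslope.and (Ioo_mem_nhdsGT hb)).exists
    have hgt : c < F (p₀, s) := by
      have := (slope_pos_iff_of_le hTs.le).1 hs
      rwa [hTc] at this
    have : ∀ᶠ p in 𝓝 p₀, c < F (p, s) :=
      continuousAt_const.eventually_lt (by fun_prop) hgt
    filter_upwards [this] with p hp
    exact (sInf_superlevel_le (hT0.trans hTs.le) hp.le).trans_lt hsb

end FirstHittingTime

section ImplicitEquation

variable {E : Type*} [NormedAddCommGroup E] [NormedSpace ℝ E] {F : E × ℝ → ℝ} {p₀ : E}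

/-- A continuous solution of a `C^n` scalar equation is `C^n` where the partial derivative in the
unknown does not vanish. -/
theorem contDiffAt_of_apply_eq_const [CompleteSpace E] {n : WithTop ℕ∞} (hn : n ≠ 0) {g : E → ℝ}
    (hF : ContDiffAt ℝ n F (p₀, g p₀)) (hg : ContinuousAt g p₀)
    (hFg : ∀ p, F (p, g p) = F (p₀, g p₀)) (hne : fderiv ℝ F (p₀, g p₀) (0, 1) ≠ 0) :
    ContDiffAt ℝ n g p₀ := by
  have hinv : (fderiv ℝ F (p₀, g p₀) ∘L .inr ℝ E ℝ).IsInvertible := by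
    refine ⟨ContinuousLinearEquiv.unitsEquivAut ℝ (Units.mk0 _ hne), ?_⟩
    ext
    simp
  refine (hF.contDiffAt_implicitFunction hn hinv).congr_of_eventuallyEq ?_
  have hmem : Tendsto (fun p => (p, g p)) (𝓝 p₀) (𝓝 (p₀, g p₀)) :=
    tendsto_id.prodMk_nhds hg
  filter_upwards [hmem.eventually (hF.eventually_apply_eq_iff_implicitFunction hn hinv)] with p hp
  exact (hp.1 (hFg p)).symm

/-- Differentiating an implicit equation twice. -/
theorem fderiv_fderiv_apply_eq_const {g : E → ℝ} (hF : ContDiff ℝ 2 F)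
    (hg : ContDiffAt ℝ 2 g p₀) {c : ℝ} (hFg : ∀ p, F (p, g p) = c) (u v : E) :
    fderiv ℝ (fderiv ℝ F) (p₀, g p₀) (u, fderiv ℝ g p₀ u) (v, fderiv ℝ g p₀ v)
      + fderiv ℝ (fderiv ℝ g) p₀ u v * fderiv ℝ F (p₀, g p₀) (0, 1) = 0 := by
  have hF' : Differentiable ℝ (fderiv ℝ F) :=
    (hF.fderiv_right (m := 1) le_rfl).differentiable one_ne_zero
  have hg' : DifferentiableAt ℝ (fderiv ℝ g) p₀ :=
    (hg.fderiv_right (m := 1) le_rfl).differentiableAt one_ne_zero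
  have hgraph {p : E} (hp : DifferentiableAt ℝ g p) :
      HasFDerivAt (fun p => (p, g p)) ((ContinuousLinearMap.id ℝ E).prod (fderiv ℝ g p)) p :=
    (hasFDerivAt_id p).prodMk hp.hasFDerivAt
  have hfirst : (fun p => fderiv ℝ F (p, g p) (v, fderiv ℝ g p v)) =ᶠ[𝓝 p₀] fun _ => 0 := by
    filter_upwards [hg.eventually (by simp)] with p hp
    have h := ((hF.differentiable two_ne_zero).differentiableAt.hasFDerivAt).comp p
      (hgraph (hp.differentiableAt two_ne_zero))
    have h' : HasFDerivAt (F ∘ fun p => (p, g p)) (0 : E →L[ℝ] ℝ) p := by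
      simpa [Function.comp_def, hFg] using hasFDerivAt_const c p
    simpa using DFunLike.congr_fun (h.unique h') v
  have hdF := (hF' (p₀, g p₀)).hasFDerivAt.comp p₀
    (hgraph (hg.differentiableAt two_ne_zero))
  have hvec := (hasFDerivAt_const v p₀).prodMk (hg'.hasFDerivAt.clm_apply (hasFDerivAt_const v p₀))
  have h := (hdF.clm_apply hvec).unique
    ((hasFDerivAt_const (0 : ℝ) p₀).congr_of_eventuallyEq hfirst)
  have h2 := DFunLike.congr_fun h u
  have hsmul (x : ℝ) : ((0 : E), x) = x • ((0 : E), (1 : ℝ)) := by simp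
  simp only [_root_.add_apply, ContinuousLinearMap.comp_apply,
    ContinuousLinearMap.prod_apply, ContinuousLinearMap.flip_apply,
    ContinuousLinearMap.id_apply, _root_.zero_apply, map_zero, zero_add,
    Function.comp_apply] at h2
  rw [hsmul (fderiv ℝ (fderiv ℝ g) p₀ u v), map_smul, smul_eq_mul] at h2
  linarith

end ImplicitEquation

/-- For a parameter-dependent twice continuously differentiable nonnegative
deviation functional `Δ(t, p)` vanishing at `t = 0`, with `Δ* > 0` and the threshold set
nonempty, if `ε > 0` is regular at `p₀` (i.e. `∂ₜΔ(T, p₀) > 0` at `T := τ(ε, p₀)`), then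
`p ↦ τ(ε, p)` is twice differentiable at `p₀` and its Hessian satisfies
`∂ₚ²τ = −(1/∂ₜΔ)·(∂ₜ²Δ·(∂ₚτ)(∂ₚτ)ᵀ + 2·S((∂ₚτ)(∂ₚ∂ₜΔ)ᵀ) + ∂ₚ²Δ)`,
with `S(M) := (M + Mᵀ)/2` and all derivatives of `Δ` evaluated at `(T, p₀)`. -/
theorem decoherence_time_hessian_in_parameters
    {r : ℕ} (Δ : ℝ → (Fin r → ℝ) → ℝ)
    (hC2 : ContDiff ℝ 2 (fun q : ℝ × (Fin r → ℝ) => Δ q.1 q.2))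
    (hnonneg : ∀ t p, 0 ≤ Δ t p) (h0 : ∀ p, Δ 0 p = 0)
    (Δstar : ℝ) (hΔstar : 0 < Δstar)
    (hne : ∀ (ε : ℝ) (p : Fin r → ℝ), 0 < ε → {t : ℝ | 0 ≤ t ∧ ε * Δstar ≤ Δ t p}.Nonempty)
    (τ : ℝ → (Fin r → ℝ) → ℝ)
    (hτ : ∀ (ε : ℝ) (p : Fin r → ℝ), τ ε p = sInf {t : ℝ | 0 ≤ t ∧ ε * Δstar ≤ Δ t p})
    (p₀ : Fin r → ℝ) (ε : ℝ) (hε : 0 < ε)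
    (T : ℝ) (hT : T = τ ε p₀)
    (hreg : 0 < deriv (fun t => Δ t p₀) T)
    -- gradient of `p ↦ τ(ε,p)` at `p₀` (coordinates in the standard basis)
    (gradτ : Fin r → ℝ)
    (hgradτ : ∀ j, gradτ j = fderiv ℝ (fun p => τ ε p) p₀ (Pi.single j 1))
    -- mixed partial derivatives `∂ₚ∂ₜΔ` at `(T, p₀)`
    (mix : Fin r → ℝ)
    (hmix : ∀ j, mix j = fderiv ℝ (fun p => deriv (fun t => Δ t p) T) p₀ (Pi.single j 1))
    -- Hessian of `p ↦ Δ(T,p)` at `p₀`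
    (HessΔ : Matrix (Fin r) (Fin r) ℝ)
    (hHessΔ : ∀ i j, HessΔ i j =
      fderiv ℝ (fun p => fderiv ℝ (fun p' => Δ T p') p (Pi.single j 1)) p₀ (Pi.single i 1)) :
    DifferentiableAt ℝ (fun p => τ ε p) p₀ ∧
    DifferentiableAt ℝ (fun p => fderiv ℝ (fun p' => τ ε p') p) p₀ ∧
    (Matrix.of fun i j =>
        fderiv ℝ (fun p => fderiv ℝ (fun p' => τ ε p') p (Pi.single j 1)) p₀ (Pi.single i 1))
      = -(deriv (fun t => Δ t p₀) T)⁻¹ •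
          (deriv (deriv (fun t => Δ t p₀)) T • Matrix.vecMulVec gradτ gradτ
            + 2 • ((1 / 2 : ℝ) •
                (Matrix.vecMulVec gradτ mix + (Matrix.vecMulVec gradτ mix)ᵀ))
            + HessΔ) := by
  have hswap : ContDiff ℝ 2 (fun q : (Fin r → ℝ) × ℝ => Δ q.2 q.1) :=
    hC2.comp (contDiff_snd.prodMk contDiff_fst)
  set F : (Fin r → ℝ) × ℝ → ℝ := fun q => Δ q.2 q.1 with hF
  have hdF : Differentiable ℝ F := hswap.differentiable two_ne_zero
  have hdF' : Differentiable ℝ (fderiv ℝ F) :=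
    (hswap.fderiv_right (m := 1) le_rfl).differentiable one_ne_zero
  have hderiv (p : Fin r → ℝ) (t : ℝ) :
      deriv (fun t => Δ t p) t = fderiv ℝ F (p, t) (0, 1) :=
    ((hdF (p, t)).hasFDerivAt.comp_hasDerivAt t
      ((hasDerivAt_const t p).prodMk (hasDerivAt_id t))).deriv
  have hfderiv (t : ℝ) (p v : Fin r → ℝ) :
      fderiv ℝ (fun p => Δ t p) p v = fderiv ℝ F (p, t) (v, 0) := by
    have := ((hdF (p, t)).hasFDerivAt.comp (f := fun p => (p, t)) p
      (hasFDerivAt_prodMk_left p t)).fderiv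
    exact DFunLike.congr_fun this v
  have hslice (t : ℝ) (p u : Fin r → ℝ) (w : (Fin r → ℝ) × ℝ) :
      fderiv ℝ (fun p => fderiv ℝ F (p, t) w) p u
        = fderiv ℝ (fderiv ℝ F) (p, t) (u, 0) w := by
    have := (((hdF' (p, t)).hasFDerivAt.comp (f := fun p => (p, t)) p
      (hasFDerivAt_prodMk_left p t)).clm_apply
      (hasFDerivAt_const w p)).fderiv
    simpa using DFunLike.congr_fun this u
  have hderiv2 : deriv (deriv (fun t => Δ t p₀)) T
      = fderiv ℝ (fderiv ℝ F) (p₀, T) (0, 1) (0, 1) := by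
    rw [show deriv (fun t => Δ t p₀) = fun t => fderiv ℝ F (p₀, t) (0, 1) from
      funext (hderiv p₀)]
    have := (((hdF' (p₀, T)).hasFDerivAt.comp_hasDerivAt T
      ((hasDerivAt_const T p₀).prodMk (hasDerivAt_id T))).clm_apply
      (hasDerivAt_const T ((0 : Fin r → ℝ), (1 : ℝ)))).deriv
    simpa using this
  have hsymm : IsSymmSndFDerivAt ℝ F (p₀, T) :=
    hswap.contDiffAt.isSymmSndFDerivAt (by simp)
  have hlt (p : Fin r → ℝ) : F (p, 0) < ε * Δstar := by
    simpa [hF, h0] using mul_pos hε hΔstar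
  have hcont : Continuous F := hdF.continuous
  have hlevel (p : Fin r → ℝ) : F (p, τ ε p) = ε * Δstar := by
    rw [hτ]
    exact apply_sInf_superlevel (f := fun t => F (p, t)) (by fun_prop) (hlt p) (hne ε p hε)
  have hτcont : ContinuousAt (fun p => τ ε p) p₀ := by
    have := tendsto_sInf_superlevel hcont hlt (hne ε · hε) (hT.trans (hτ ε p₀)) hreg
    simpa only [ContinuousAt, ← hT, hτ] using this
  have hA : fderiv ℝ F (p₀, τ ε p₀) (0, 1) ≠ 0 := by
    rw [← hT, ← hderiv]
    exact hreg.ne'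
  have hτC2 : ContDiffAt ℝ 2 (fun p => τ ε p) p₀ :=
    contDiffAt_of_apply_eq_const two_ne_zero hswap.contDiffAt hτcont
      (fun p => (hlevel p).trans (hlevel p₀).symm) hA
  have hτ' : DifferentiableAt ℝ (fderiv ℝ (fun p => τ ε p)) p₀ :=
    (hτC2.fderiv_right (m := 1) le_rfl).differentiableAt one_ne_zero
  refine ⟨hτC2.differentiableAt two_ne_zero, hτ', ?_⟩
  ext i j
  have hkey := fderiv_fderiv_apply_eq_const hswap hτC2 hlevel (Pi.single i 1) (Pi.single j 1)
  have hsplit (k : Fin r) : ((Pi.single k 1 : Fin r → ℝ), gradτ k)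
      = (Pi.single k 1, 0) + gradτ k • ((0 : Fin r → ℝ), (1 : ℝ)) := by simp
  rw [← hgradτ, ← hgradτ, ← hT, hsplit i, hsplit j] at hkey
  simp only [map_add, map_smul, _root_.add_apply, _root_.smul_apply,
    smul_eq_mul, hsymm.eq (0, 1) (Pi.single j 1, 0)] at hkey
  have hHess : fderiv ℝ (fun p => fderiv ℝ (fun p' => τ ε p') p (Pi.single j 1)) p₀
      (Pi.single i 1) = fderiv ℝ (fderiv ℝ (fun p => τ ε p)) p₀ (Pi.single i 1)
        (Pi.single j 1) := by
    simp [fderiv_clm_apply hτ' (differentiableAt_const _)]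
  rw [← hT] at hA
  simp only [hfderiv, hderiv, hslice] at hmix hHessΔ
  simp only [Matrix.of_apply, Matrix.smul_apply, Matrix.add_apply, Matrix.vecMulVec_apply,
    Matrix.transpose_apply, hHess, hderiv2, hderiv, hmix, hHessΔ, smul_eq_mul]
  rw [nsmul_eq_mul]
  field_simp
  push_cast
  linarith
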